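/- Suppose ν is a ℤ^d-valuation on K that is trivial on k, that ν(g) ∈ ℕ^d for every m ≥ 0 and every g ∈ V^m∖{0} (so Γ ⊆ ℕ×ℕ^d), that ν has one-dimensional leaves on R(V), and that the semigroup Γ = Γ_ν(V) is finitely generated as a monoid. Then there exists a filtration F : ℕ → (k-subspaces of A) with F_j ⊆ F_{j+1} for all j, 1 ∈ F_0, ⋃_j F_j = A, and F_i · F_j ⊆ F_{i+j}, such that the Rees algebra ℛ = {p ∈ A[t] : the coefficient of t^j in p lies in F_j for all j}, a k[t]-subalgebra of the polynomial ring A[t], satisfies: (a) ℛ is a finitely generated k-algebra; (b) ℛ is flat as a k[t]-module; (c) there is a k-algebra isomorphism ℛ/(t·ℛ) ≅ k[Γ], the semigroup algebra over k of the monoid Γ; and (d) the inclusion ℛ ↪ A[t] induces a ring isomorphism on localizations ℛ[t⁻¹] ≅ A[t][t⁻¹] after inverting t. -/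

import Mathlib

open Polynomial

instance (d : ℕ) : WellFoundedLT (Fin d) := Finite.to_wellFoundedLT

variable {k K : Type*} [Field k] [Field K] [Algebra k K] {d : ℕ}

/-- The ring `R(V) = ⊕ V^m`, realized as the subalgebra of `K[T]` of polynomials whose
`m`-th coefficient lies in `V^m`. -/
def ringRV (V : Submodule k K) : Subalgebra k (Polynomial K) where
  carrier := {p | ∀ m : ℕ, p.coeff m ∈ V ^ m}
  add_mem' := by
    intro p q hp hq m
    rw [Polynomial.coeff_add]
    exact add_mem (hp m) (hq m)
  zero_mem' := by
    intro m
    rw [Polynomial.coeff_zero]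
    exact zero_mem _
  mul_mem' := by
    intro p q hp hq m
    rw [Polynomial.coeff_mul]
    refine Submodule.sum_mem _ ?_
    rintro ⟨i, j⟩ hij
    rw [Finset.HasAntidiagonal.mem_antidiagonal] at hij
    have h1 : p.coeff i * q.coeff j ∈ V ^ i * V ^ j := Submodule.mul_mem_mul (hp i) (hq j)
    rwa [← pow_add, hij] at h1
  one_mem' := by
    intro m
    rw [Polynomial.coeff_one]
    split
    · next h => subst h; rw [pow_zero]; exact Submodule.one_le.mp le_rfl
    · exact zero_mem _
  algebraMap_mem' := by
    intro c m
    rw [Polynomial.algebraMap_apply, Polynomial.coeff_C]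
    split
    · next h => subst h; rw [pow_zero]; exact Submodule.algebraMap_mem c
    · exact zero_mem _

/-- The Rees algebra of a multiplicative filtration, inside `S[t]`. -/
def reesAlg {R S : Type*} [CommSemiring R] [CommRing S] [Algebra R S]
    (F : ℕ → Submodule R S) (h1 : (1 : S) ∈ F 0)
    (hmulF : ∀ i j : ℕ, ∀ f ∈ F i, ∀ g ∈ F j, f * g ∈ F (i + j)) :
    Subalgebra R (Polynomial S) where
  carrier := {p | ∀ j : ℕ, p.coeff j ∈ F j}
  add_mem' := by
    intro p q hp hq m
    rw [Polynomial.coeff_add]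
    exact add_mem (hp m) (hq m)
  zero_mem' := by
    intro m
    rw [Polynomial.coeff_zero]
    exact zero_mem _
  mul_mem' := by
    intro p q hp hq m
    rw [Polynomial.coeff_mul]
    refine Submodule.sum_mem _ ?_
    rintro ⟨i, j⟩ hij
    rw [Finset.HasAntidiagonal.mem_antidiagonal] at hij
    exact hij ▸ hmulF i j _ (hp i) _ (hq j)
  one_mem' := by
    intro m
    rw [Polynomial.coeff_one]
    split
    · next h => subst h; exact h1
    · exact zero_mem _
  algebraMap_mem' := by
    intro c m
    rw [Polynomial.algebraMap_apply, Polynomial.coeff_C]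
    split
    · next h =>
        subst h
        rw [Algebra.algebraMap_eq_smul_one]
        exact Submodule.smul_mem _ c h1
    · exact zero_mem _

/-- The valuation semigroup `Γ_ν(V)` as an additive submonoid of `ℕ × ℤ^d`. -/
def valGammaMonoid (ν : K → Lex (Fin d → ℤ)) (V : Submodule k K)
    (hmul : ∀ f g : K, f ≠ 0 → g ≠ 0 → ν (f * g) = ν f + ν g)
    (htriv : ∀ c : k, c ≠ 0 → ν (algebraMap k K c) = 0) :
    AddSubmonoid (ℕ × Lex (Fin d → ℤ)) where
  carrier := {p | ∃ g ∈ V ^ p.1, g ≠ 0 ∧ ν g = p.2}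
  zero_mem' := by
    refine ⟨1, ?_, one_ne_zero, ?_⟩
    · show (1 : K) ∈ V ^ (0 : ℕ)
      rw [pow_zero]
      exact Submodule.one_le.mp le_rfl
    · show ν 1 = 0
      rw [← map_one (algebraMap k K)]
      exact htriv 1 one_ne_zero
  add_mem' := by
    rintro ⟨m, u⟩ ⟨n, v⟩ ⟨g, hg, hg0, hgu⟩ ⟨h, hh, hh0, hhv⟩
    refine ⟨g * h, ?_, mul_ne_zero hg0 hh0, ?_⟩
    · show g * h ∈ V ^ (m + n)
      rw [pow_add]
      exact Submodule.mul_mem_mul hg hh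
    · show ν (g * h) = u + v
      rw [hmul g h hg0 hh0, hgu, hhv]

section ReesAlgebra

variable {R A Γ : Type*} [Field R] [CommRing A] [Algebra R A]

/-- The Rees algebra of an exhaustive filtration of a domain becomes `A[t, t⁻¹]` after
inverting `t`. -/
theorem bijective_awayMap_reesAlg [IsDomain A] (F : ℕ → Submodule R A) (h1 : (1 : A) ∈ F 0)
    (hmono : Monotone F)
    (hmulF : ∀ i j : ℕ, ∀ f ∈ F i, ∀ g ∈ F j, f * g ∈ F (i + j))
    (hex : ∀ a : A, ∃ j, a ∈ F j) (hX : (X : A[X]) ∈ reesAlg F h1 hmulF) :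
    Function.Bijective (Localization.awayMap ((reesAlg F h1 hmulF).val.toRingHom)
      (⟨X, hX⟩ : ↥(reesAlg F h1 hmulF))) := by
  constructor
  · rw [Localization.awayMap_injective_iff]
    intro a ha
    exact ⟨0, by simpa using ha⟩
  · rw [Localization.awayMap_surjective_iff]
    intro p
    have key : ∃ N, ∀ i, p.coeff i ∈ F N := by
      induction p using Polynomial.induction_on' with
      | add p q hp hq =>
        obtain ⟨N, hN⟩ := hp
        obtain ⟨M, hM⟩ := hq
        refine ⟨max N M, fun i => ?_⟩
        rw [coeff_add]
        exact add_mem (hmono (le_max_left _ _) (hN i)) (hmono (le_max_right _ _) (hM i))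
      | monomial n a =>
        obtain ⟨N, hN⟩ := hex a
        refine ⟨N, fun i => ?_⟩
        rw [coeff_monomial]
        split_ifs
        · exact hN
        · exact zero_mem _
    obtain ⟨N, hN⟩ := key
    refine ⟨⟨X ^ N * p, fun j => ?_⟩, N, by simp⟩
    rw [coeff_X_pow_mul']
    split_ifs with h
    · exact hmono h (hN _)
    · exact zero_mem _

/-- The Rees algebra of a filtration of a domain is flat over `R[t]`. -/
theorem flat_reesAlg [IsDomain A] (F : ℕ → Submodule R A) (h1 : (1 : A) ∈ F 0)
    (hmulF : ∀ i j : ℕ, ∀ f ∈ F i, ∀ g ∈ F j, f * g ∈ F (i + j))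
    (hX : (X : A[X]) ∈ reesAlg F h1 hmulF) :
    letI : Algebra R[X] ↥(reesAlg F h1 hmulF) :=
      (aeval (⟨X, hX⟩ : ↥(reesAlg F h1 hmulF))).toRingHom.toAlgebra
    Module.Flat R[X] ↥(reesAlg F h1 hmulF) := by
  let : Algebra R[X] ↥(reesAlg F h1 hmulF) :=
    (aeval (⟨X, hX⟩ : ↥(reesAlg F h1 hmulF))).toRingHom.toAlgebra
  have hinj : Function.Injective (algebraMap R[X] ↥(reesAlg F h1 hmulF)) := by
    intro p q hpq
    have h2 : aeval (X : A[X]) p = aeval (X : A[X]) q := by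
      have := congrArg (reesAlg F h1 hmulF).val hpq
      change (reesAlg F h1 hmulF).val (aeval _ p) = (reesAlg F h1 hmulF).val (aeval _ q) at this
      rwa [← aeval_algHom_apply, ← aeval_algHom_apply] at this
    have h3 : ∀ r : R[X], aeval (X : A[X]) r = r.map (algebraMap R A) := by
      intro r
      simp [aeval_def, eval₂_eq_sum, Polynomial.map]
    rw [h3, h3] at h2
    exact map_injective _ (algebraMap R A).injective h2
  have : Module.IsTorsionFree R[X] ↥(reesAlg F h1 hmulF) :=
    Module.isTorsionFree_iff_algebraMap_injective.2 hinj
  infer_instance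

end ReesAlgebra

section WeightFiltration

variable {R A Γ : Type*} [Field R] [CommRing A] [Algebra R A]

/-- The filtration of an algebra with basis `e` by the weight of the basis elements. -/
def weightFiltration (e : Module.Basis Γ R A) (w : Γ → ℕ) (j : ℕ) : Submodule R A :=
  Submodule.span R (e '' {γ | w γ ≤ j})

/-- The span of the basis elements of weight less than `j`. -/
def weightLT (e : Module.Basis Γ R A) (w : Γ → ℕ) (j : ℕ) : Submodule R A :=
  Submodule.span R (e '' {γ | w γ < j})

variable {e : Module.Basis Γ R A}

theorem basis_mem_weightFiltration {w : Γ → ℕ} {γ : Γ} {j : ℕ} (h : w γ ≤ j) :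
    e γ ∈ weightFiltration e w j :=
  Submodule.subset_span ⟨γ, h, rfl⟩

theorem weightFiltration_mono (w : Γ → ℕ) : Monotone (weightFiltration e w) :=
  fun _ _ hij => Submodule.span_mono (Set.image_mono fun _ h => le_trans h hij)

theorem weightLT_le_weightFiltration {w : Γ → ℕ} {i j : ℕ} (hij : i ≤ j) :
    weightLT e w i ≤ weightFiltration e w j :=
  Submodule.span_mono (Set.image_mono fun _ h => le_trans (le_of_lt h) hij)

theorem exists_mem_weightFiltration (w : Γ → ℕ) (a : A) : ∃ j, a ∈ weightFiltration e w j := by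
  refine ⟨(e.repr a).support.sup w, ?_⟩
  rw [weightFiltration, e.mem_span_image]
  intro γ hγ
  exact Finset.le_sup (f := w) hγ

variable [AddCommMonoid Γ] {w : Γ →+ ℕ}

theorem mul_mem_weightFiltration
    (hmul : ∀ γ δ, e γ * e δ - e (γ + δ) ∈ weightLT e w (w (γ + δ))) (i j : ℕ) :
    ∀ f ∈ weightFiltration e w i, ∀ g ∈ weightFiltration e w j,
      f * g ∈ weightFiltration e w (i + j) := by
  intro f hf g hg
  induction hf, hg using Submodule.span_induction₂ with
  | mem_mem x y hx hy =>
    obtain ⟨γ, hγ, rfl⟩ := hx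
    obtain ⟨δ, hδ, rfl⟩ := hy
    have hle : w (γ + δ) ≤ i + j := by
      rw [map_add]; exact add_le_add hγ hδ
    rw [← sub_add_cancel (e γ * e δ) (e (γ + δ))]
    exact add_mem (weightLT_le_weightFiltration hle (hmul γ δ)) (basis_mem_weightFiltration hle)
  | zero_left => simp
  | zero_right => simp
  | add_left x y z _ _ _ h1 h2 => rw [add_mul]; exact add_mem h1 h2
  | add_right x y z _ _ _ h1 h2 => rw [mul_add]; exact add_mem h1 h2
  | smul_left r x y _ _ h => rw [smul_mul_assoc]; exact Submodule.smul_mem _ _ h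
  | smul_right r x y _ _ h => rw [mul_smul_comm]; exact Submodule.smul_mem _ _ h

/-- The Rees algebra of the weight filtration is spanned by the monomials `e γ t ^ j` with
`w γ ≤ j`. -/
theorem reesAlg_eq_span (h1 : (1 : A) ∈ weightFiltration e w 0)
    (hmulF : ∀ i j : ℕ, ∀ f ∈ weightFiltration e w i, ∀ g ∈ weightFiltration e w j,
      f * g ∈ weightFiltration e w (i + j)) :
    Subalgebra.toSubmodule (reesAlg (weightFiltration e w) h1 hmulF) =
      Submodule.span R {p | ∃ γ j, w γ ≤ j ∧ p = monomial j (e γ)} := by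
  apply le_antisymm
  · intro p hp
    rw [p.as_sum_support]
    refine Submodule.sum_mem _ fun j _ => ?_
    have hj : p.coeff j ∈ weightFiltration e w j := hp j
    generalize p.coeff j = a at hj
    induction hj using Submodule.span_induction with
    | mem x hx =>
      obtain ⟨γ, hγ, rfl⟩ := hx
      exact Submodule.subset_span ⟨γ, j, hγ, rfl⟩
    | zero => simp
    | add x y _ _ hx hy => rw [map_add]; exact add_mem hx hy
    | smul r x _ hx => rw [← smul_monomial]; exact Submodule.smul_mem _ _ hx
  · rw [Submodule.span_le]
    rintro _ ⟨γ, j, hγ, rfl⟩ i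
    rw [coeff_monomial]
    split_ifs with h
    · exact basis_mem_weightFiltration (h ▸ hγ)
    · exact zero_mem _

theorem fg_reesAlg_weightFiltration [AddMonoid.FG Γ] (he : e 0 = 1)
    (hmul : ∀ γ δ, e γ * e δ - e (γ + δ) ∈ weightLT e w (w (γ + δ)))
    (h1 : (1 : A) ∈ weightFiltration e w 0)
    (hmulF : ∀ i j : ℕ, ∀ f ∈ weightFiltration e w i, ∀ g ∈ weightFiltration e w j,
      f * g ∈ weightFiltration e w (i + j))
    (hX : (X : A[X]) ∈ reesAlg (weightFiltration e w) h1 hmulF) :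
    (reesAlg (weightFiltration e w) h1 hmulF).FG := by
  obtain ⟨S, hS⟩ := AddMonoid.FG.fg_top (M := Γ)
  set gen : Set A[X] := insert X ((fun s => monomial (w s) (e s)) '' (S : Set Γ)) with hgen
  have hfin : gen.Finite := (S.finite_toSet.image _).insert _
  set B := Algebra.adjoin R gen with hB
  have hXB : (X : A[X]) ∈ B := Algebra.subset_adjoin (Set.mem_insert _ _)
  have hshift : ∀ (a : A) (i j : ℕ), i ≤ j → monomial i a ∈ B → monomial j a ∈ B := by
    intro a i j hij h
    obtain ⟨n, rfl⟩ := Nat.exists_eq_add_of_le hij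
    rw [← monomial_mul_X_pow]
    exact mul_mem h (pow_mem hXB n)
  have hmem : ∀ j, ∀ γ, w γ ≤ j → monomial (w γ) (e γ) ∈ B := by
    intro j
    induction j using Nat.strong_induction_on with
    | _ j ih =>
    intro γ
    have hγ : γ ∈ AddSubmonoid.closure (S : Set Γ) := by rw [hS]; trivial
    induction hγ using AddSubmonoid.closure_induction with
    | mem x hx => exact fun _ => Algebra.subset_adjoin (Or.inr ⟨x, hx, rfl⟩)
    | zero => intro _; rw [he, map_zero]; exact one_mem B
    | add x y _ _ hx hy =>
      intro hxy
      have hxy' : w x + w y ≤ j := by rwa [← map_add]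
      have hlow : ∀ a ∈ weightLT e w (w (x + y)), monomial (w (x + y)) a ∈ B := by
        intro a ha
        induction ha using Submodule.span_induction with
        | mem a ha =>
          obtain ⟨δ, hδ, rfl⟩ := ha
          have hδ' : w δ < w (x + y) := hδ
          exact hshift _ _ _ hδ'.le (ih (w δ) (hδ'.trans_le hxy) δ le_rfl)
        | zero => simp
        | add a b _ _ ha hb => rw [map_add]; exact add_mem ha hb
        | smul r a _ ha => rw [← smul_monomial]; exact Subalgebra.smul_mem _ ha _
      have hprod := mul_mem (hx (by lia)) (hy (by lia))
      rw [monomial_mul_monomial, ← map_add] at hprod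
      have := sub_mem hprod (hlow _ (hmul x y))
      rwa [← map_sub, sub_sub_cancel] at this
  have hBeq : B = reesAlg (weightFiltration e w) h1 hmulF := by
    apply le_antisymm
    · rw [hB, Algebra.adjoin_le_iff, hgen, Set.insert_subset_iff]
      refine ⟨hX, ?_⟩
      rintro _ ⟨s, -, rfl⟩ i
      change (monomial (w s) (e s)).coeff i ∈ _
      rw [coeff_monomial]
      split_ifs with h
      · exact basis_mem_weightFiltration h.le
      · exact zero_mem _
    · rw [← OrderEmbedding.le_iff_le Subalgebra.toSubmodule, reesAlg_eq_span, Submodule.span_le]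
      rintro _ ⟨γ, j, hγ, rfl⟩
      exact hshift _ _ _ hγ (hmem j γ hγ)
  rw [← hBeq]
  exact ⟨hfin.toFinset, by simp [hB]⟩

variable (e w) in
/-- The linear map `A[t] → R[Γ]` sending `e γ t ^ j` to `γ` if `w γ = j` and to `0` otherwise. -/
noncomputable def leadingForm : A[X] →ₗ[R] AddMonoidAlgebra R Γ :=
  Polynomial.lsum fun j => e.constr R fun γ =>
    open Classical in if w γ = j then AddMonoidAlgebra.single γ 1 else 0

open Classical in
theorem leadingForm_monomial (j : ℕ) (γ : Γ) :
    leadingForm e w (monomial j (e γ)) =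
      if w γ = j then AddMonoidAlgebra.single γ 1 else 0 := by
  simp [leadingForm, Polynomial.lsum_apply, sum_monomial_index, Module.Basis.constr_basis]

theorem leadingForm_coeff (p : A[X]) (γ : Γ) :
    (leadingForm e w p).coeff γ = e.repr (p.coeff (w γ)) γ := by
  classical
  induction p using Polynomial.induction_on' with
  | add p q hp hq => simp [hp, hq]
  | monomial n a =>
    induction e.mem_span a using Submodule.span_induction with
    | zero => simp
    | add a b _ _ ha hb => simp_all
    | smul r a _ ha =>
      rw [← smul_monomial, map_smul, AddMonoidAlgebra.coeff_smul, Finsupp.smul_apply, ha]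
      simp
    | mem a ha =>
      obtain ⟨δ, rfl⟩ := ha
      rw [leadingForm_monomial, coeff_monomial]
      by_cases h : γ = δ
      · subst h
        by_cases h' : w γ = n
        · simp [h']
        · simp [h', Ne.symm h']
      · split_ifs <;> simp_all [eq_comm]

theorem leadingForm_monomial_of_mem_weightLT {i j : ℕ} (hij : i ≤ j) {a : A}
    (ha : a ∈ weightLT e w i) : leadingForm e w (monomial j a) = 0 := by
  induction ha using Submodule.span_induction with
  | mem a ha =>
    obtain ⟨γ, hγ, rfl⟩ := ha
    have hγ' : w γ < i := hγ
    rw [leadingForm_monomial, if_neg (by lia)]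
  | zero => simp
  | add a b _ _ ha hb => simp [ha, hb]
  | smul r a _ ha => rw [← smul_monomial, map_smul, ha, smul_zero]

theorem leadingForm_mul (hmul : ∀ γ δ, e γ * e δ - e (γ + δ) ∈ weightLT e w (w (γ + δ)))
    (h1 : (1 : A) ∈ weightFiltration e w 0)
    (hmulF : ∀ i j : ℕ, ∀ f ∈ weightFiltration e w i, ∀ g ∈ weightFiltration e w j,
      f * g ∈ weightFiltration e w (i + j))
    {p q : A[X]} (hp : p ∈ reesAlg (weightFiltration e w) h1 hmulF)
    (hq : q ∈ reesAlg (weightFiltration e w) h1 hmulF) :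
    leadingForm e w (p * q) = leadingForm e w p * leadingForm e w q := by
  rw [← Subalgebra.mem_toSubmodule, reesAlg_eq_span] at hp hq
  induction hp, hq using Submodule.span_induction₂ with
  | mem_mem x y hx hy =>
    obtain ⟨γ, i, hγ, rfl⟩ := hx
    obtain ⟨δ, j, hδ, rfl⟩ := hy
    have hle : w (γ + δ) ≤ i + j := by
      rw [map_add]; exact add_le_add hγ hδ
    rw [monomial_mul_monomial, ← sub_add_cancel (e γ * e δ) (e (γ + δ)), map_add, map_add,
      leadingForm_monomial_of_mem_weightLT hle (hmul γ δ), zero_add]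
    simp only [leadingForm_monomial, map_add]
    by_cases hi : w γ = i
    · by_cases hj : w δ = j
      · rw [if_pos (by lia), if_pos hi, if_pos hj, AddMonoidAlgebra.single_mul_single, one_mul]
      · rw [if_neg (by lia), if_neg hj, mul_zero]
    · rw [if_neg (by lia), if_neg hi, zero_mul]
  | zero_left => simp
  | zero_right => simp
  | add_left x y z _ _ _ h1 h2 => rw [add_mul, map_add, h1, h2, map_add, add_mul]
  | add_right x y z _ _ _ h1 h2 => rw [mul_add, map_add, h1, h2, map_add, mul_add]
  | smul_left r x y _ _ h => rw [smul_mul_assoc, map_smul, h, map_smul, smul_mul_assoc]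
  | smul_right r x y _ _ h => rw [mul_smul_comm, map_smul, h, map_smul, mul_smul_comm]

/-- The special fibre of the Rees algebra of the weight filtration is the semigroup algebra. -/
theorem nonempty_reesAlg_quotient_algEquiv (he : e 0 = 1)
    (hmul : ∀ γ δ, e γ * e δ - e (γ + δ) ∈ weightLT e w (w (γ + δ)))
    (h1 : (1 : A) ∈ weightFiltration e w 0)
    (hmulF : ∀ i j : ℕ, ∀ f ∈ weightFiltration e w i, ∀ g ∈ weightFiltration e w j,
      f * g ∈ weightFiltration e w (i + j))
    (hX : (X : A[X]) ∈ reesAlg (weightFiltration e w) h1 hmulF) :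
    Nonempty ((↥(reesAlg (weightFiltration e w) h1 hmulF) ⧸
      (Ideal.span {(⟨X, hX⟩ : ↥(reesAlg (weightFiltration e w) h1 hmulF))} :
        Ideal ↥(reesAlg (weightFiltration e w) h1 hmulF))) ≃ₐ[R] AddMonoidAlgebra R Γ) := by
  classical
  let ψ : ↥(reesAlg (weightFiltration e w) h1 hmulF) →ₐ[R] AddMonoidAlgebra R Γ :=
    AlgHom.ofLinearMap
      (leadingForm e w ∘ₗ (reesAlg (weightFiltration e w) h1 hmulF).val.toLinearMap)
      (by
        change leadingForm e w (1 : A[X]) = 1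
        rw [← monomial_zero_one, ← he, leadingForm_monomial, map_zero, if_pos rfl]
        rfl)
      (fun p q => leadingForm_mul hmul h1 hmulF p.2 q.2)
  have hψ : ∀ p, ψ p = leadingForm e w (p : A[X]) := fun _ => rfl
  have hsurj : Function.Surjective ψ := by
    rw [← AlgHom.coe_toLinearMap, ← LinearMap.range_eq_top, eq_top_iff]
    intro x _
    induction x using AddMonoidAlgebra.induction_linear with
    | zero => exact zero_mem _
    | add x y hx hy => exact add_mem (hx trivial) (hy trivial)
    | single γ r =>
      have : AddMonoidAlgebra.single γ r =
          r • (AddMonoidAlgebra.single γ 1 : AddMonoidAlgebra R Γ) := by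
        simp
      rw [this]
      refine Submodule.smul_mem _ _ ⟨⟨monomial (w γ) (e γ), fun i => ?_⟩, ?_⟩
      · rw [coeff_monomial]
        split_ifs with h
        · exact basis_mem_weightFiltration h.le
        · exact zero_mem _
      · change leadingForm e w (monomial (w γ) (e γ)) = _
        rw [leadingForm_monomial, if_pos rfl]
  have hker : RingHom.ker ψ =
      Ideal.span {(⟨X, hX⟩ : ↥(reesAlg (weightFiltration e w) h1 hmulF))} := by
    apply le_antisymm
    · rintro ⟨p, hp⟩ hpψ
      have hp0 : leadingForm e w p = 0 := hpψ
      have hlt : ∀ j γ, e.repr (p.coeff j) γ ≠ 0 → w γ < j := by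
        intro j γ hγ
        have hle : w γ ≤ j := (e.mem_span_image.1 (hp j)) (Finsupp.mem_support_iff.2 hγ)
        refine lt_of_le_of_ne hle ?_
        rintro rfl
        apply hγ
        rw [← leadingForm_coeff, hp0]
        rfl
      have h0 : p.coeff 0 = 0 := by
        rw [← e.repr.map_eq_zero_iff]
        ext γ
        by_contra h
        exact absurd (hlt 0 γ h) (Nat.not_lt_zero _)
      have hdiv : p.divX ∈ reesAlg (weightFiltration e w) h1 hmulF := by
        intro j
        rw [coeff_divX, weightFiltration, e.mem_span_image]
        intro γ hγ
        exact Nat.le_of_lt_succ (hlt (j + 1) γ (Finsupp.mem_support_iff.1 hγ))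
      rw [Ideal.mem_span_singleton]
      refine ⟨⟨p.divX, hdiv⟩, Subtype.ext ?_⟩
      change p = X * p.divX
      conv_lhs => rw [← X_mul_divX_add p, h0, C_0, add_zero]
    · rw [Ideal.span_singleton_le_iff_mem]
      change leadingForm e w (X : A[X]) = 0
      rw [← monomial_one_one_eq_X, ← he, leadingForm_monomial, if_neg (by simp)]
  exact ⟨(Ideal.quotientEquivAlgOfEq R hker.symm).trans
    (Ideal.quotientKerAlgEquivOfSurjective hsurj)⟩

end WeightFiltration

section Weight

/-- Finitely many lexicographically positive vectors are simultaneously positive for some integral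
linear functional. -/
theorem exists_addMonoidHom_pos_of_lex_pos : ∀ {d : ℕ} (P : Finset (Fin d → ℤ)),
    (∀ v ∈ P, ∃ i, (∀ j < i, v j = 0) ∧ 0 < v i) → ∃ l : (Fin d → ℤ) →+ ℤ, ∀ v ∈ P, 0 < l v
  | 0, P, hP => ⟨0, fun v hv => (hP v hv).choose.elim0⟩
  | d + 1, P, hP => by
    classical
    obtain ⟨l, hl⟩ := exists_addMonoidHom_pos_of_lex_pos
      ((P.filter fun v => v 0 = 0).image fun v : Fin (d + 1) → ℤ => fun i => v i.succ) (by
        simp only [Finset.mem_image, Finset.mem_filter]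
        rintro _ ⟨v, ⟨hv, hv0⟩, rfl⟩
        obtain ⟨i, hi, hpos⟩ := hP v hv
        obtain ⟨i, rfl⟩ := Fin.exists_succ_eq.2 (by rintro rfl; lia : i ≠ 0)
        exact ⟨i, fun j hj => hi _ (Fin.succ_lt_succ_iff.2 hj), hpos⟩)
    let tail : (Fin (d + 1) → ℤ) →+ (Fin d → ℤ) :=
      { toFun := fun v i => v i.succ, map_zero' := rfl, map_add' := fun _ _ => rfl }
    let c : ℤ := 1 + ∑ v ∈ P, |l (tail v)|
    refine ⟨(AddMonoidHom.mulLeft c).comp (Pi.evalAddMonoidHom _ 0) + l.comp tail, fun v hv => ?_⟩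
    change 0 < c * v 0 + l (tail v)
    obtain ⟨i, hi, hpos⟩ := hP v hv
    by_cases h0 : v 0 = 0
    · rw [h0, mul_zero, zero_add]
      exact hl _ (Finset.mem_image.2 ⟨v, Finset.mem_filter.2 ⟨hv, h0⟩, rfl⟩)
    · have hv0 : 0 < v 0 := by
        by_cases hi0 : i = 0
        · rwa [hi0] at hpos
        · exact absurd (hi 0 (Fin.pos_of_ne_zero hi0)) h0
      have hle : |l (tail v)| ≤ ∑ v ∈ P, |l (tail v)| :=
        Finset.single_le_sum (f := fun v => |l (tail v)|) (fun _ _ => abs_nonneg _) hv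
      have := neg_abs_le (l (tail v))
      have hc : c ≤ c * v 0 := by
        apply le_mul_of_one_le_right _ hv0
        have := abs_nonneg (l (tail v))
        lia
      lia

/-- A finitely generated graded monoid of lexicographically ordered vectors admits a natural number
valued weight decreasing along any given finite set of increasing pairs of the same degree. -/
theorem exists_weight {d : ℕ} (G : AddSubmonoid (ℕ × Lex (Fin d → ℤ))) (hG : G.FG)
    (h0 : ∀ g ∈ G, g.1 = 0 → g = 0) (P : Finset (G × G))
    (hP : ∀ p ∈ P, p.1.1.1 = p.2.1.1 ∧ p.1.1.2 < p.2.1.2) :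
    ∃ w : G →+ ℕ, ∀ p ∈ P, w p.2 < w p.1 := by
  classical
  obtain ⟨l, hl⟩ := exists_addMonoidHom_pos_of_lex_pos
    (P.image fun p => ofLex (p.2.1.2 - p.1.1.2)) (by
      simp only [Finset.mem_image]
      rintro _ ⟨p, hp, rfl⟩
      obtain ⟨i, hi, hlt⟩ := (hP p hp).2
      refine ⟨i, fun j hj => sub_eq_zero.2 (hi j hj).symm, sub_pos.2 hlt⟩)
  obtain ⟨S, hS⟩ := hG
  let l' : Lex (Fin d → ℤ) →+ ℤ := l
  let c : ℤ := ∑ s ∈ S, |l' s.2|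
  let W : ℕ × Lex (Fin d → ℤ) →+ ℤ :=
    ((AddMonoidHom.mulLeft c).comp (Nat.castAddMonoidHom ℤ)).comp (AddMonoidHom.fst _ _) -
      l'.comp (AddMonoidHom.snd _ _)
  have hW : ∀ g, W g = c * (g.1 : ℤ) - l' g.2 := fun _ => rfl
  have hpos : ∀ g ∈ G, 0 ≤ W g := by
    intro g hg
    have hg' : g ∈ AddSubmonoid.closure (S : Set (ℕ × Lex (Fin d → ℤ))) := hS ▸ hg
    clear hg
    induction hg' using AddSubmonoid.closure_induction with
    | mem s hs =>
      by_cases hs0 : s.1 = 0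
      · rw [h0 s (hS ▸ AddSubmonoid.subset_closure hs) hs0, map_zero]
      · rw [hW]
        have hle : |l' s.2| ≤ c :=
          Finset.single_le_sum (f := fun s : ℕ × Lex (Fin d → ℤ) => |l' s.2|)
            (fun _ _ => abs_nonneg _) hs
        have h1 := le_abs_self (l' s.2)
        have hc : c ≤ c * (s.1 : ℤ) :=
          le_mul_of_one_le_right ((abs_nonneg _).trans hle) (by lia)
        lia
    | zero => rw [map_zero]
    | add x y _ _ hx hy => rw [map_add]; exact add_nonneg hx hy
  refine ⟨{ toFun := fun g => (W g).toNat, map_zero' := by simp, map_add' := fun x y => ?_ }, ?_⟩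
  · rw [AddSubmonoid.coe_add, map_add, Int.toNat_add (hpos _ x.2) (hpos _ y.2)]
  · intro p hp
    change (W p.2).toNat < (W p.1).toNat
    have h1 := hpos _ p.2.2
    have h2 := hl _ (Finset.mem_image_of_mem _ hp)
    have h3 : l' (p.2.1.2 - p.1.1.2) = l' p.2.1.2 - l' p.1.1.2 := map_sub _ _ _
    have h4 : 0 < l' (p.2.1.2 - p.1.1.2) := h2
    have h5 : W p.2 < W p.1 := by
      rw [hW, hW, (hP p hp).1]
      lia
    lia

end Weight

section MonomialBasis

variable {R A Γ σ : Type*} [Field R] [CommRing A] [Algebra R A] [AddCommMonoid Γ] [IsCancelAdd Γ]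
  [Fintype σ]

/-- If monomials in `x` of the same degree agree modulo `e`-combinations of larger degree, and
finitely many increments of degree can be made to decrease an additive weight, then `e` is
multiplicative up to terms of lower weight. -/
theorem exists_weight_basis_mul_sub_mem_weightLT (e : Module.Basis Γ R A) (lt : Γ → Γ → Prop)
    (hw : ∀ P : Finset (Γ × Γ), (∀ p ∈ P, lt p.1 p.2) → ∃ w : Γ →+ ℕ, ∀ p ∈ P, w p.2 < w p.1)
    (deg : (σ → ℕ) →+ Γ) (x : σ → A) (nf : Γ → σ → ℕ) (hnf : ∀ γ, deg (nf γ) = γ)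
    (he : ∀ γ, e γ = ∏ s, x s ^ nf γ s)
    (hx : ∀ α β, deg α = deg β → ∏ s, x s ^ α s - ∏ s, x s ^ β s ∈
      Submodule.span R (e '' {δ | lt (deg α) δ})) :
    ∃ w : Γ →+ ℕ, ∀ γ δ, e γ * e δ - e (γ + δ) ∈ weightLT e w (w (γ + δ)) := by
  classical
  obtain ⟨T, hT⟩ := AddSubmonoid.fg_eqLocusM (deg.comp (AddMonoidHom.fst (σ → ℕ) (σ → ℕ)))
    (deg.comp (AddMonoidHom.snd (σ → ℕ) (σ → ℕ)))
  let m : (σ → ℕ) → A := fun α => ∏ s, x s ^ α s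
  have hm : ∀ α β, m (α + β) = m α * m β := fun α β => by
    simp only [m, Pi.add_apply, pow_add, Finset.prod_mul_distrib]
  have hTdeg : ∀ p ∈ T, deg p.1 = deg p.2 := by
    intro p hp
    have : p ∈ AddSubmonoid.closure (T : Set ((σ → ℕ) × (σ → ℕ))) := AddSubmonoid.subset_closure hp
    rw [hT] at this
    exact this
  obtain ⟨w, hw⟩ := hw
    (T.biUnion fun p => (e.repr (m p.1 - m p.2)).support.image fun δ => (deg p.1, δ)) (by
      simp only [Finset.mem_biUnion, Finset.mem_image]
      rintro _ ⟨p, hp, δ, hδ, rfl⟩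
      exact e.mem_span_image.1 (hx p.1 p.2 (hTdeg p hp)) hδ)
  refine ⟨w, ?_⟩
  let W : ℕ → Submodule R A := fun j => Submodule.span R (m '' {α | w (deg α) < j})
  have hWmul : ∀ α j, ∀ a ∈ W j, m α * a ∈ W (w (deg α) + j) := by
    intro α j a ha
    induction ha using Submodule.span_induction with
    | mem a ha =>
      obtain ⟨β, hβ, rfl⟩ := ha
      have hβ' : w (deg β) < j := hβ
      refine Submodule.subset_span ⟨α + β, ?_, hm α β⟩
      change w (deg (α + β)) < _
      rw [map_add, map_add]
      lia
    | zero => simp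
    | add a b _ _ ha hb => rw [mul_add]; exact add_mem ha hb
    | smul r a _ ha => rw [mul_smul_comm]; exact Submodule.smul_mem _ _ ha
  have hsub : ∀ α β, deg α = deg β → m α - m β ∈ W (w (deg α)) := by
    suffices h : ∀ p ∈ AddSubmonoid.closure (T : Set ((σ → ℕ) × (σ → ℕ))),
        m p.1 - m p.2 ∈ W (w (deg p.1)) by
      intro α β hαβ
      refine h (α, β) ?_
      rw [hT]
      exact hαβ
    intro p hp
    have hpdeg : ∀ p ∈ AddSubmonoid.closure (T : Set ((σ → ℕ) × (σ → ℕ))), deg p.1 = deg p.2 := by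
      rw [hT]
      exact fun p hp => hp
    induction hp using AddSubmonoid.closure_induction with
    | mem p hp =>
      rw [← e.linearCombination_repr (m p.1 - m p.2), Finsupp.linearCombination_apply]
      refine Submodule.sum_mem _ fun δ hδ => Submodule.smul_mem _ _ ?_
      have hlt := hw (deg p.1, δ)
        (Finset.mem_biUnion.2 ⟨p, hp, Finset.mem_image.2 ⟨δ, hδ, rfl⟩⟩)
      refine Submodule.subset_span ⟨nf δ, ?_, (he δ).symm⟩
      change w (deg (nf δ)) < _
      rwa [hnf]
    | zero => simp
    | add p q hp hq ihp ihq =>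
      have h1 := hWmul p.1 _ _ ihq
      have h2 := hWmul q.2 _ _ ihp
      rw [← hpdeg q hq, add_comm] at h2
      have h3 := add_mem h1 h2
      rw [Prod.fst_add, Prod.snd_add, hm, hm, map_add, map_add]
      convert h3 using 1
      ring
  have hWle : ∀ j, W j ≤ weightLT e w j := by
    intro j
    induction j using Nat.strong_induction_on with
    | _ j ih =>
    refine Submodule.span_le.2 ?_
    rintro _ ⟨α, hα, rfl⟩
    have hα' : w (deg α) < j := hα
    have h1 := ih _ hα' (hsub α (nf (deg α)) (hnf _).symm)
    have h2 : m (nf (deg α)) = e (deg α) := (he _).symm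
    rw [← sub_add_cancel (m α) (m (nf (deg α)))]
    refine add_mem (Submodule.span_mono (Set.image_mono fun δ hδ => ?_) h1) ?_
    · exact lt_trans hδ hα'
    · rw [h2]
      exact Submodule.subset_span ⟨_, hα', rfl⟩
  intro γ δ
  have h := hWle _ (hsub (nf γ + nf δ) (nf (γ + δ)) (by simp only [map_add, hnf]))
  rw [map_add, hnf, hnf, hm] at h
  rwa [he γ, he δ, he (γ + δ)]

end MonomialBasis

section ValuationBasis

variable {k K L : Type*} [Field k] [Field K] [Algebra k K] [AddCommGroup L] [LinearOrder L]
  [IsOrderedAddMonoid L]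

/-- A function on the nonzero elements of a field satisfying the axioms of a valuation, extended
by `⊤` at zero. -/
noncomputable def AddValuation.ofNonzero (ν : K → L)
    (hadd : ∀ f g : K, f ≠ 0 → g ≠ 0 → f + g ≠ 0 → min (ν f) (ν g) ≤ ν (f + g))
    (hmul : ∀ f g : K, f ≠ 0 → g ≠ 0 → ν (f * g) = ν f + ν g) : AddValuation K (WithTop L) :=
  open Classical in
  AddValuation.of (fun x => if x = 0 then ⊤ else (ν x : WithTop L)) (by simp)
    (by
      have := hmul 1 1 one_ne_zero one_ne_zero
      rw [mul_one, left_eq_add] at this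
      simp [this])
    (by
      intro x y
      by_cases hx : x = 0
      · rw [hx, zero_add]; exact min_le_right _ _
      by_cases hy : y = 0
      · rw [hy, add_zero]; exact min_le_left _ _
      by_cases hxy : x + y = 0
      · simp [hxy]
      simp only [hx, hy, hxy, if_false]
      exact_mod_cast hadd x y hx hy hxy)
    (by
      intro x y
      by_cases hx : x = 0
      · simp [hx]
      by_cases hy : y = 0
      · simp [hy]
      simp [hx, hy, hmul x y hx hy])

theorem AddValuation.ofNonzero_apply {ν : K → L}
    {hadd : ∀ f g : K, f ≠ 0 → g ≠ 0 → f + g ≠ 0 → min (ν f) (ν g) ≤ ν (f + g)}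
    {hmul : ∀ f g : K, f ≠ 0 → g ≠ 0 → ν (f * g) = ν f + ν g} {x : K} (hx : x ≠ 0) :
    AddValuation.ofNonzero ν hadd hmul x = ν x := by
  simp [AddValuation.ofNonzero, hx]

variable (v : AddValuation K (WithTop L)) (V : Submodule k K)

/-- Restricted to homogeneous fractions of `R(V)`, the value map has a multiplicative section, whose
values at elements of the value semigroup are approximated by elements of the powers of `V`. -/
theorem exists_multiplicative_section [Module.Finite ℤ L]
    (hleaf : ∀ (m : ℕ), ∀ f ∈ V ^ m, ∀ g ∈ V ^ m, f ≠ 0 → v f = v g →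
      ∃ c : k, v f < v (f - algebraMap k K c * g))
    (G : AddSubmonoid (ℕ × L)) (hG : ∀ p, p ∈ G ↔ ∃ g ∈ V ^ p.1, v g = p.2) :
    ∃ s : G → K, s 0 = 1 ∧ (∀ γ δ, s (γ + δ) = s γ * s δ) ∧ (∀ γ : G, v (s γ) = (γ : ℕ × L).2) ∧
      ∀ γ : G, ∃ b ∈ V ^ (γ : ℕ × L).1, v (s γ) < v (s γ - b) := by
  have hne : ∀ {x : K} {u : L}, v x = u → x ≠ 0 := by
    rintro x u h rfl
    simp at h
  let H : AddSubgroup (ℤ × Additive Kˣ) :=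
    { carrier := {x | ∃ p q : ℕ, ∃ a ∈ V ^ p, ∃ b ∈ V ^ q, a ≠ 0 ∧ b ≠ 0 ∧ x.1 = (p : ℤ) - q ∧
        (x.2.toMul : K) = a / b}
      zero_mem' := by
        refine ⟨0, 0, 1, ?_, 1, ?_, one_ne_zero, one_ne_zero, by simp, by simp⟩ <;>
        · rw [pow_zero]; exact Submodule.one_le.mp le_rfl
      add_mem' := by
        rintro x y ⟨p, q, a, ha, b, hb, ha0, hb0, h1, h2⟩
          ⟨p', q', a', ha', b', hb', ha0', hb0', h1', h2'⟩
        refine ⟨p + p', q + q', a * a', ?_, b * b', ?_, mul_ne_zero ha0 ha0', mul_ne_zero hb0 hb0',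
          ?_, ?_⟩
        · rw [pow_add]; exact Submodule.mul_mem_mul ha ha'
        · rw [pow_add]; exact Submodule.mul_mem_mul hb hb'
        · rw [Prod.fst_add, h1, h1']; push_cast; ring
        · rw [Prod.snd_add, toMul_add, Units.val_mul, h2, h2', div_mul_div_comm]
      neg_mem' := by
        rintro x ⟨p, q, a, ha, b, hb, ha0, hb0, h1, h2⟩
        refine ⟨q, p, b, hb, a, ha, hb0, ha0, ?_, ?_⟩
        · rw [Prod.fst_neg, h1]; ring
        · rw [Prod.snd_neg, toMul_neg, Units.val_inv_eq_inv_val, h2, inv_div] }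
  have hu : ∀ u : Kˣ, v (u : K) ≠ ⊤ := fun u => (v.ne_top_iff).2 u.ne_zero
  let val : Additive Kˣ →+ L :=
    { toFun := fun u => (v (u.toMul : K)).untop (hu _)
      map_zero' := by simp
      map_add' := fun x y => by
        rw [← WithTop.coe_inj]
        simp }
  have hval : ∀ u : Additive Kˣ, (val u : WithTop L) = v (u.toMul : K) := fun u =>
    WithTop.coe_untop _ _
  let φ : H →ₗ[ℤ] ℤ × L :=
    (((AddMonoidHom.fst ℤ (Additive Kˣ)).prod
      (val.comp (AddMonoidHom.snd ℤ (Additive Kˣ)))).comp H.subtype).toIntLinearMap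
  have hφ : ∀ h : H, φ h = ((h : ℤ × Additive Kˣ).1, val (h : ℤ × Additive Kˣ).2) := fun _ => rfl
  obtain ⟨σ, hσ⟩ := Module.projective_lifting_property φ.rangeRestrict LinearMap.id
    φ.surjective_rangeRestrict
  have hmem : ∀ γ : G, (((γ : ℕ × L).1 : ℤ), (γ : ℕ × L).2) ∈ LinearMap.range φ := by
    intro γ
    obtain ⟨g, hg, hgv⟩ := (hG γ).1 γ.2
    have hg0 : g ≠ 0 := hne hgv
    refine ⟨⟨(((γ : ℕ × L).1 : ℤ), Additive.ofMul (Units.mk0 g hg0)),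
      ⟨(γ : ℕ × L).1, 0, g, hg, 1, ?_, hg0, one_ne_zero, by simp, by simp⟩⟩, ?_⟩
    · rw [pow_zero]; exact Submodule.one_le.mp le_rfl
    · rw [hφ, Prod.mk.injEq]
      refine ⟨rfl, WithTop.coe_injective ?_⟩
      rw [hval, ← hgv]
      rfl
  have hφσ : ∀ γ : G, φ (σ ⟨_, hmem γ⟩) = (((γ : ℕ × L).1 : ℤ), (γ : ℕ × L).2) := fun γ =>
    congrArg Subtype.val (LinearMap.congr_fun hσ ⟨_, hmem γ⟩)
  have hsv : ∀ γ : G, v (((σ ⟨_, hmem γ⟩ : H) : ℤ × Additive Kˣ).2.toMul : K) =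
      (γ : ℕ × L).2 := by
    intro γ
    rw [← hval]
    exact congrArg _ (congrArg Prod.snd (hφσ γ))
  refine ⟨fun γ => ((σ ⟨_, hmem γ⟩ : H) : ℤ × Additive Kˣ).2.toMul, ?_, ?_, hsv, ?_⟩
  · have : (⟨_, hmem 0⟩ : LinearMap.range φ) = 0 := by ext <;> simp
    beta_reduce
    rw [this, map_zero]
    rfl
  · intro γ δ
    have : (⟨_, hmem (γ + δ)⟩ : LinearMap.range φ) = ⟨_, hmem γ⟩ + ⟨_, hmem δ⟩ := by ext <;> simp
    beta_reduce
    rw [this, map_add]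
    rfl
  · intro γ
    obtain ⟨g, hg, hgv⟩ := (hG γ).1 γ.2
    obtain ⟨p, q, a, ha, b, hb, ha0, hb0, h1, h2⟩ := (σ ⟨_, hmem γ⟩).2
    have hpq : (γ : ℕ × L).1 + q = p := by
      have : ((γ : ℕ × L).1 : ℤ) = p - q := (congrArg Prod.fst (hφσ γ)).symm.trans h1
      lia
    have hs := hsv γ
    beta_reduce
    rw [h2] at hs ⊢
    have hsb : a / b * b = a := div_mul_cancel₀ _ hb0
    have hva : v a = v (g * b) := by
      rw [v.map_mul, hgv, ← hs, ← v.map_mul, hsb]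
    obtain ⟨c, hc⟩ := hleaf p a ha (g * b)
      (by rw [← hpq, pow_add]; exact Submodule.mul_mem_mul hg hb) ha0 hva
    refine ⟨c • g, Submodule.smul_mem _ _ hg, ?_⟩
    have hbt : v b ≠ ⊤ := v.ne_top_iff.2 hb0
    have h3 : v (a / b) + v b < v (a / b - c • g) + v b := by
      rw [← v.map_mul, ← v.map_mul, hsb, sub_mul, hsb, Algebra.smul_def, mul_assoc]
      exact hc
    exact lt_of_add_lt_add_right h3

/-- Elements of the powers of `V` representing every value of the value semigroup span all powers
of `V`. -/
theorem mem_span_of_one_dimensional_leaves [FiniteDimensional k V]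
    (hk : ∀ c : k, c ≠ 0 → v (algebraMap k K c) = 0)
    (hleaf : ∀ (m : ℕ), ∀ f ∈ V ^ m, ∀ g ∈ V ^ m, f ≠ 0 → v f = v g →
      ∃ c : k, v f < v (f - algebraMap k K c * g))
    (G : AddSubmonoid (ℕ × L)) (hG : ∀ p, p ∈ G ↔ ∃ g ∈ V ^ p.1, v g = p.2)
    (b : G → K) (hbV : ∀ γ : G, b γ ∈ V ^ (γ : ℕ × L).1) (hbv : ∀ γ : G, v (b γ) = (γ : ℕ × L).2)
    (m : ℕ) (f : K) (hf : f ∈ V ^ m) :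
    f ∈ Submodule.span k (b '' {γ | (γ : ℕ × L).1 = m ∧ v f ≤ (γ : ℕ × L).2}) := by
  have : FiniteDimensional k ↥(V ^ m) := by
    rw [FiniteDimensional, Module.Finite.iff_fg] at *
    exact Submodule.FG.pow ‹_› m
  let W : WithTop L → Submodule k ↥(V ^ m) := fun u =>
    { carrier := {g | u ≤ v g}
      zero_mem' := by simp
      add_mem' := fun hx hy => v.map_le_add hx hy
      smul_mem' := by
        intro c x hx
        by_cases hc : c = 0
        · simp [hc]
        · change u ≤ v (c • (x : K))
          rw [Algebra.smul_def, v.map_mul, hk c hc, zero_add]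
          exact hx }
  suffices h : ∀ (S : Submodule k ↥(V ^ m)), ∀ f : ↥(V ^ m), W (v f) = S →
      (f : K) ∈ Submodule.span k (b '' {γ | (γ : ℕ × L).1 = m ∧ v f ≤ (γ : ℕ × L).2}) from
    h _ ⟨f, hf⟩ rfl
  intro S
  induction S using WellFoundedLT.induction with
  | _ S ih =>
  rintro f rfl
  by_cases hf0 : (f : K) = 0
  · rw [hf0]; exact zero_mem _
  obtain ⟨u, hu⟩ := WithTop.ne_top_iff_exists.1 (v.ne_top_iff.2 hf0)
  let γ : G := ⟨(m, u), (hG _).2 ⟨f, f.2, hu.symm⟩⟩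
  have hγv : v (f : K) = v (b γ) := by rw [hbv, ← hu]
  obtain ⟨c, hc⟩ := hleaf m f f.2 (b γ) (hbV γ) hf0 hγv
  let f' : ↥(V ^ m) := f - c • ⟨b γ, hbV γ⟩
  have hf' : (f' : K) = f - algebraMap k K c * b γ := by
    simp [f', Algebra.smul_def]
  have hlt : W (v (f' : K)) < W (v (f : K)) := by
    rw [SetLike.lt_iff_le_and_exists]
    refine ⟨fun g hg => ?_, f, le_refl (v (f : K)), fun h => ?_⟩
    · exact le_trans (hf' ▸ hc.le) hg
    · exact absurd (h : v (f' : K) ≤ v (f : K)) (not_le.2 (hf' ▸ hc))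
  have hmem := ih _ hlt f' rfl
  have hfeq : (f : K) = f' + c • b γ := by
    rw [hf', Algebra.smul_def, sub_add_cancel]
  suffices h : (f' : K) + c • b γ ∈
      Submodule.span k (b '' {γ | (γ : ℕ × L).1 = m ∧ v f ≤ (γ : ℕ × L).2}) by rwa [← hfeq] at h
  refine add_mem (Submodule.span_mono (Set.image_mono ?_) hmem)
    (Submodule.smul_mem _ _ (Submodule.subset_span ⟨γ, ⟨rfl, hu.ge⟩, rfl⟩))
  exact fun δ hδ => ⟨hδ.1, le_trans (hf' ▸ hc.le) hδ.2⟩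

theorem linearIndependent_monomial_of_valuation (hk : ∀ c : k, c ≠ 0 → v (algebraMap k K c) = 0)
    (G : AddSubmonoid (ℕ × L)) (b : G → K) (hbv : ∀ γ : G, v (b γ) = (γ : ℕ × L).2) :
    LinearIndependent k fun γ : G => (monomial (γ : ℕ × L).1 (b γ) : K[X]) := by
  classical
  rw [linearIndependent_iff]
  intro l hl
  by_contra hne
  obtain ⟨γ, hγ, hmin⟩ := l.support.exists_min_image (fun γ => (γ : ℕ × L).2)
    (Finsupp.support_nonempty_iff.2 hne)
  have hcoeff := congrArg (fun p => p.coeff (γ : ℕ × L).1) hl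
  rw [Finsupp.linearCombination_apply, Finsupp.sum] at hcoeff
  simp only [finsetSum_coeff, coeff_smul, coeff_monomial, coeff_zero] at hcoeff
  rw [← Finset.add_sum_erase _ _ hγ, if_pos rfl] at hcoeff
  have hvc : ∀ δ ∈ l.support, v (l δ • b δ) = (δ : ℕ × L).2 := by
    intro δ hδ
    rw [Algebra.smul_def, v.map_mul, hk _ (Finsupp.mem_support_iff.1 hδ), zero_add, hbv]
  have hlt : v (l γ • b γ) < v (∑ δ ∈ l.support.erase γ,
      l δ • if (δ : ℕ × L).1 = (γ : ℕ × L).1 then b δ else 0) := by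
    rw [hvc γ hγ]
    refine v.map_lt_sum WithTop.coe_ne_top fun δ hδ => ?_
    rw [Finset.mem_erase] at hδ
    split_ifs with h
    · rw [hvc δ hδ.2, WithTop.coe_lt_coe]
      refine lt_of_le_of_ne (hmin δ hδ.2) fun h' => hδ.1 (Subtype.ext (Prod.ext h h'.symm))
    · simp
  have := v.map_add_eq_of_lt_left hlt
  rw [hcoeff, v.map_zero, hvc γ hγ] at this
  exact WithTop.coe_ne_top this.symm

theorem mem_span_monomial_of_one_dimensional_leaves [FiniteDimensional k V]
    (hk : ∀ c : k, c ≠ 0 → v (algebraMap k K c) = 0)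
    (hleaf : ∀ (m : ℕ), ∀ f ∈ V ^ m, ∀ g ∈ V ^ m, f ≠ 0 → v f = v g →
      ∃ c : k, v f < v (f - algebraMap k K c * g))
    (G : AddSubmonoid (ℕ × L)) (hG : ∀ p, p ∈ G ↔ ∃ g ∈ V ^ p.1, v g = p.2)
    (b : G → K) (hbV : ∀ γ : G, b γ ∈ V ^ (γ : ℕ × L).1) (hbv : ∀ γ : G, v (b γ) = (γ : ℕ × L).2)
    (e : G → ringRV V) (he : ∀ γ : G, (e γ : K[X]) = monomial (γ : ℕ × L).1 (b γ))
    (m : ℕ) (p : ringRV V) (f : K) (hp : (p : K[X]) = monomial m f) :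
    p ∈ Submodule.span k (e '' {γ | (γ : ℕ × L).1 = m ∧ v f ≤ (γ : ℕ × L).2}) := by
  have hf : f ∈ V ^ m := by simpa [hp] using p.2 m
  have hmem := Submodule.mem_map_of_mem (f := (monomial m).restrictScalars k)
    (mem_span_of_one_dimensional_leaves v V hk hleaf G hG b hbV hbv m f hf)
  rw [Submodule.map_span, LinearMap.restrictScalars_apply, ← hp] at hmem
  have hinj : Function.Injective (ringRV V).val.toLinearMap := Subtype.val_injective
  rw [← Submodule.comap_map_eq_of_injective hinj (Submodule.span k _), Submodule.mem_comap,
    Submodule.map_span]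
  refine Submodule.span_mono ?_ hmem
  rintro _ ⟨_, ⟨γ, hγ, rfl⟩, rfl⟩
  refine ⟨e γ, ⟨γ, hγ, rfl⟩, ?_⟩
  change (e γ : K[X]) = monomial m (b γ)
  rw [he, hγ.1]

/-- If the value semigroup is finitely generated and its elements of equal degree can be separated
by weights, then `R(V)` has a homogeneous basis indexed by the value semigroup whose multiplication
is that of the semigroup up to terms of lower weight. -/
theorem exists_basis_mul_sub_mem_weightLT [FiniteDimensional k V] [Module.Finite ℤ L]
    (hk : ∀ c : k, c ≠ 0 → v (algebraMap k K c) = 0)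
    (hleaf : ∀ (m : ℕ), ∀ f ∈ V ^ m, ∀ g ∈ V ^ m, f ≠ 0 → v f = v g →
      ∃ c : k, v f < v (f - algebraMap k K c * g))
    (G : AddSubmonoid (ℕ × L)) (hG : ∀ p, p ∈ G ↔ ∃ g ∈ V ^ p.1, v g = p.2) (hfg : G.FG)
    (hw : ∀ P : Finset (G × G), (∀ p ∈ P, p.1.1.1 = p.2.1.1 ∧ p.1.1.2 < p.2.1.2) →
      ∃ w : G →+ ℕ, ∀ p ∈ P, w p.2 < w p.1) :
    ∃ e : Module.Basis G k (ringRV V), e 0 = 1 ∧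
      ∃ w : G →+ ℕ, ∀ γ δ, e γ * e δ - e (γ + δ) ∈ weightLT e w (w (γ + δ)) := by
  classical
  obtain ⟨s, hs0, hsadd, hsv, hsb⟩ := exists_multiplicative_section v V hleaf G hG
  choose b₀ hb₀V hb₀v using hsb
  obtain ⟨S, hS⟩ := ((AddMonoid.fg_iff_addSubmonoid_fg G).2 hfg).fg_top
  let deg : (S → ℕ) →+ G :=
    { toFun := fun α => ∑ i, α i • (i : G)
      map_zero' := by simp
      map_add' := fun α β => by simp [add_smul, Finset.sum_add_distrib] }
  have hdeg : ∀ α, deg α = ∑ i, α i • (i : G) := fun _ => rfl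
  have hsurj : Function.Surjective deg := by
    rw [← AddMonoidHom.mrange_eq_top, eq_top_iff, ← hS, AddSubmonoid.closure_le]
    intro γ hγ
    refine ⟨Pi.single ⟨γ, hγ⟩ 1, ?_⟩
    rw [hdeg, Finset.sum_eq_single ⟨γ, hγ⟩] <;> simp +contextual
  obtain ⟨nf, hnf, hnf0⟩ : ∃ nf : G → S → ℕ, (∀ γ, deg (nf γ) = γ) ∧ nf 0 = 0 := by
    refine ⟨Function.update (Function.surjInv hsurj) 0 0, fun γ => ?_, Function.update_self ..⟩
    by_cases hγ : γ = 0
    · rw [hγ, Function.update_self, map_zero]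
    · rw [Function.update_of_ne hγ]
      exact Function.surjInv_eq hsurj γ
  let x : S → ringRV V := fun i => ⟨monomial (i : G).1.1 (b₀ i), fun m => by
    rw [coeff_monomial]
    split_ifs with h
    · exact h ▸ hb₀V i
    · exact zero_mem _⟩
  let Q : G → ringRV V → Prop := fun γ a => ∃ c, (a : K[X]) = monomial γ.1.1 c ∧
    v (s γ) < v (s γ - c)
  have hQ0 : Q 0 1 := ⟨1, by simp, by simp [hs0]⟩
  have hQv : ∀ {γ : G} {c : K}, v (s γ) < v (s γ - c) → v c = γ.1.2 := by
    intro γ c hc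
    rw [v.map_sub_swap] at hc
    rw [← hsv, v.map_eq_of_lt_sub hc]
  have hQadd : ∀ γ δ a a', Q γ a → Q δ a' → Q (γ + δ) (a * a') := by
    rintro γ δ a a' ⟨c, hac, hc⟩ ⟨c', hac', hc'⟩
    refine ⟨c * c', ?_, ?_⟩
    · rw [MulMemClass.coe_mul, hac, hac', monomial_mul_monomial]
      rfl
    · rw [hsadd, show s γ * s δ - c * c' = s γ * (s δ - c') + (s γ - c) * c' by ring]
      refine v.map_lt_add ?_ ?_
      · rw [v.map_mul, v.map_mul]
        exact WithTop.add_lt_add_left (by simp [hsv]) hc'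
      · rw [v.map_mul, v.map_mul, hQv hc', ← hsv δ]
        exact WithTop.add_lt_add_right (by simp [hsv]) hc
  have hQnsmul : ∀ γ a, Q γ a → ∀ n : ℕ, Q (n • γ) (a ^ n) := by
    intro γ a h n
    induction n with
    | zero => simpa using hQ0
    | succ n ih => rw [succ_nsmul, pow_succ]; exact hQadd _ _ _ _ ih h
  have hQ : ∀ α, Q (deg α) (∏ i, x i ^ α i) := by
    intro α
    rw [hdeg]
    induction (Finset.univ : Finset S) using Finset.induction_on with
    | empty => simpa using hQ0
    | insert i T hi ih =>
      rw [Finset.sum_insert hi, Finset.prod_insert hi]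
      exact hQadd _ _ _ _ (hQnsmul _ _ ⟨b₀ i, rfl, hb₀v i⟩ _) ih
  have hQnf : ∀ γ, Q γ (∏ i, x i ^ nf γ i) := fun γ => by
    have := hQ (nf γ)
    rwa [hnf] at this
  choose b hb hbs using hQnf
  have hbv : ∀ γ : G, v (b γ) = γ.1.2 := fun γ => hQv (hbs γ)
  let e₀ : G → ringRV V := fun γ => ∏ i, x i ^ nf γ i
  have hbV : ∀ γ : G, b γ ∈ V ^ γ.1.1 := fun γ => by
    have := (e₀ γ).2 γ.1.1
    rwa [hb, coeff_monomial, if_pos rfl] at this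
  have hspan := mem_span_monomial_of_one_dimensional_leaves v V hk hleaf G hG b hbV hbv e₀ hb
  have hli : LinearIndependent k e₀ := by
    refine LinearIndependent.of_comp (ringRV V).val.toLinearMap ?_
    have hcomp : (ringRV V).val.toLinearMap ∘ e₀ = fun γ : G => monomial γ.1.1 (b γ) := funext hb
    rw [hcomp]
    exact linearIndependent_monomial_of_valuation v hk G b hbv
  have htop : ⊤ ≤ Submodule.span k (Set.range e₀) := by
    intro p _
    have hp : p = ∑ m ∈ (p : K[X]).support, (⟨monomial m ((p : K[X]).coeff m), fun n => by
        rw [coeff_monomial]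
        split_ifs with h
        · exact h ▸ p.2 m
        · exact zero_mem _⟩ : ringRV V) := by
      ext1
      rw [AddSubmonoidClass.coe_finsetSum]
      exact (p : K[X]).as_sum_support
    rw [hp]
    refine Submodule.sum_mem _ fun m _ => ?_
    exact Submodule.span_mono (Set.image_subset_range _ _) (hspan m _ _ rfl)
  let e := Module.Basis.mk hli htop
  have he : ⇑e = e₀ := Module.Basis.coe_mk hli htop
  refine ⟨e, by simp [he, e₀, hnf0], ?_⟩
  refine exists_weight_basis_mul_sub_mem_weightLT e
    (fun γ δ => γ.1.1 = δ.1.1 ∧ γ.1.2 < δ.1.2) hw deg x nf hnf (fun γ => congrFun he γ) ?_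
  intro α β hαβ
  obtain ⟨c, hac, hc⟩ := hQ α
  obtain ⟨c', hac', hc'⟩ := hQ β
  rw [← hαβ] at hac' hc'
  have hlt : ((deg α).1.2 : WithTop L) < v (c - c') := by
    rw [← hsv, show c - c' = (s (deg α) - c') - (s (deg α) - c) by ring]
    exact lt_of_lt_of_le (lt_min hc' hc) (v.map_sub _ _)
  have hmem := hspan (deg α).1.1 (∏ i, x i ^ α i - ∏ i, x i ^ β i) (c - c') (by
    rw [AddSubgroupClass.coe_sub, hac, hac', map_sub])
  rw [he]
  refine Submodule.span_mono (Set.image_mono ?_) hmem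
  exact fun δ hδ => ⟨hδ.1.symm, WithTop.coe_lt_coe.1 (hlt.trans_le hδ.2)⟩

end ValuationBasis

theorem okounkov_toric_degeneration
    {k K : Type*} [Field k] [Field K] [Algebra k K] {d : ℕ}
    (ν : K → Lex (Fin d → ℤ)) (V : Submodule k K)
    (hVne : V ≠ ⊥) (hVfd : FiniteDimensional k ↥V)
    (hadd : ∀ f g : K, f ≠ 0 → g ≠ 0 → f + g ≠ 0 → min (ν f) (ν g) ≤ ν (f + g))
    (hmul : ∀ f g : K, f ≠ 0 → g ≠ 0 → ν (f * g) = ν f + ν g)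
    (htriv : ∀ c : k, c ≠ 0 → ν (algebraMap k K c) = 0)
    (hnat : ∀ (m : ℕ), ∀ g ∈ V ^ m, g ≠ 0 → ∀ i : Fin d, 0 ≤ ofLex (ν g) i)
    (hleaf : ∀ (m : ℕ), ∀ f ∈ V ^ m, ∀ g ∈ V ^ m, f ≠ 0 → g ≠ 0 → ν f = ν g →
      ∃ c : k, f = algebraMap k K c * g ∨
        (f - algebraMap k K c * g ≠ 0 ∧ ν f < ν (f - algebraMap k K c * g)))
    (hfg : (valGammaMonoid ν V hmul htriv).FG) :
    ∃ F : ℕ → Submodule k ↥(ringRV V),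
      ∃ (h1 : (1 : ↥(ringRV V)) ∈ F 0)
        (_ : ∀ j : ℕ, F j ≤ F (j + 1))
        (hmulF : ∀ i j : ℕ, ∀ f ∈ F i, ∀ g ∈ F j, f * g ∈ F (i + j)),
        (∀ a : ↥(ringRV V), ∃ j, a ∈ F j) ∧
        ∃ hX : (Polynomial.X : Polynomial ↥(ringRV V)) ∈ reesAlg F h1 hmulF,
          -- (a) finitely generated as a k-algebra
          (reesAlg F h1 hmulF).FG ∧
          -- (b) flat as a k[t]-module, where t acts as X ∈ ℛ
          (letI : Algebra (Polynomial k) ↥(reesAlg F h1 hmulF) :=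
            (Polynomial.aeval (⟨Polynomial.X, hX⟩ : ↥(reesAlg F h1 hmulF))).toRingHom.toAlgebra
           Module.Flat (Polynomial k) ↥(reesAlg F h1 hmulF)) ∧
          -- (c) ℛ/(tℛ) ≅ k[Γ] as k-algebras
          Nonempty
            ((↥(reesAlg F h1 hmulF) ⧸
                (Ideal.span {(⟨Polynomial.X, hX⟩ : ↥(reesAlg F h1 hmulF))} :
                  Ideal ↥(reesAlg F h1 hmulF))) ≃ₐ[k]
              AddMonoidAlgebra k ↥(valGammaMonoid ν V hmul htriv)) ∧
          -- (d) the inclusion ℛ ↪ A[t] induces an isomorphism after inverting t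
          Function.Bijective
            (Localization.awayMap ((reesAlg F h1 hmulF).val.toRingHom)
              (⟨Polynomial.X, hX⟩ : ↥(reesAlg F h1 hmulF))) := by
  let v := AddValuation.ofNonzero ν hadd hmul
  have hv : ∀ {x : K}, x ≠ 0 → v x = ν x := fun hx => AddValuation.ofNonzero_apply hx
  have hk : ∀ c : k, c ≠ 0 → v (algebraMap k K c) = 0 := by
    intro c hc
    rw [hv ((_root_.map_ne_zero _).2 hc), htriv c hc, WithTop.coe_zero]
  have hleaf' : ∀ (m : ℕ), ∀ f ∈ V ^ m, ∀ g ∈ V ^ m, f ≠ 0 → v f = v g →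
      ∃ c : k, v f < v (f - algebraMap k K c * g) := by
    intro m f hf g hg hf0 hfg
    have hg0 : g ≠ 0 := v.ne_top_iff.1 (hfg ▸ v.ne_top_iff.2 hf0)
    rw [hv hf0, hv hg0, WithTop.coe_inj] at hfg
    obtain ⟨c, hc | ⟨hc0, hc⟩⟩ := hleaf m f hf g hg hf0 hg0 hfg
    · refine ⟨c, ?_⟩
      rw [← hc, sub_self, v.map_zero, hv hf0]
      exact WithTop.coe_lt_top _
    · exact ⟨c, by rw [hv hf0, hv hc0]; exact_mod_cast hc⟩
  have hG : ∀ p, p ∈ valGammaMonoid ν V hmul htriv ↔ ∃ g ∈ V ^ p.1, v g = p.2 := by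
    intro p
    refine exists_congr fun g => and_congr_right fun _ => ⟨fun h => ?_, fun h => ?_⟩
    · rw [hv h.1, h.2]
    · have hg0 : g ≠ 0 := v.ne_top_iff.1 (h ▸ WithTop.coe_ne_top)
      rw [hv hg0, WithTop.coe_inj] at h
      exact ⟨hg0, h⟩
  have h0 : ∀ g ∈ valGammaMonoid ν V hmul htriv, g.1 = 0 → g = 0 := by
    rintro ⟨m, u⟩ ⟨g, hg, hg0, hgu⟩ (rfl : m = 0)
    rw [pow_zero, Submodule.mem_one] at hg
    obtain ⟨c, rfl⟩ := hg
    rw [htriv c fun h => hg0 (by rw [h, map_zero])] at hgu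
    exact Prod.ext rfl hgu.symm
  have : Module.Finite ℤ (Lex (Fin d → ℤ)) := inferInstanceAs (Module.Finite ℤ (Fin d → ℤ))
  have : AddMonoid.FG (valGammaMonoid ν V hmul htriv) :=
    (AddMonoid.fg_iff_addSubmonoid_fg _).2 hfg
  obtain ⟨e, he, w, hew⟩ := exists_basis_mul_sub_mem_weightLT v V hk hleaf' _ hG hfg
    (exists_weight _ hfg h0)
  have h1 : (1 : ringRV V) ∈ weightFiltration e w 0 :=
    he ▸ basis_mem_weightFiltration (map_zero w).le
  have hmono := weightFiltration_mono (e := e) w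
  have hmulF := mul_mem_weightFiltration hew
  have hX : (X : Polynomial (ringRV V)) ∈ reesAlg (weightFiltration e w) h1 hmulF := by
    intro j
    rw [coeff_X]
    split_ifs
    · exact hmono (Nat.zero_le j) h1
    · exact zero_mem _
  exact ⟨weightFiltration e w, h1, fun j => hmono j.le_succ, hmulF, exists_mem_weightFiltration w,
    hX, fg_reesAlg_weightFiltration he hew h1 hmulF hX, flat_reesAlg _ h1 hmulF hX,
    nonempty_reesAlg_quotient_algEquiv he hew h1 hmulF hX,
    bijective_awayMap_reesAlg _ h1 hmono hmulF (exists_mem_weightFiltration w) hX⟩
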